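/- arXiv:2003.13564 — 7 statements merged into one kernel-verified Lean document; each statement's English description precedes it below -/
import Mathlib

section
/- For every natural number n ≥ 1, every real number α, and every assignment of bits x : Fin n → {0,1} (regarded as real numbers), one has exp(i·α·∏_{j=1}^{n} x_j) = ∏_{∅ ≠ S ⊆ Fin n} exp(i·(−1)^{|S|+1}·(α/2^{n−1})·(⊕_{j∈S} x_j)), where the product on the right ranges over all nonempty subsets S of Fin n and ⊕_{j∈S} x_j denotes the XOR (parity) of the bits x_j for j ∈ S, regarded as 0 or 1 in ℝ. -/
/-- The character `b ↦ (-1) ^ b` of `ZMod 2` turns parities into products. -/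
theorem one_sub_two_mul_val_sum {ι : Type*} (S : Finset ι) (x : ι → ZMod 2) :
    (1 - 2 * ((∑ j ∈ S, x j).val : ℂ)) = ∏ j ∈ S, (1 - 2 * ((x j).val : ℂ)) := by
  classical
  have mul_val : ∀ a b : ZMod 2,
      (1 - 2 * ((a + b).val : ℤ)) = (1 - 2 * (a.val : ℤ)) * (1 - 2 * (b.val : ℤ)) := by
    decide
  induction S using Finset.induction_on with
  | empty => simp
  | insert a S ha ih =>
    rw [Finset.sum_insert ha, Finset.prod_insert ha, ← ih]
    exact_mod_cast mul_val (x a) (∑ j ∈ S, x j)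

/-- The product of a nonempty family of bits as an alternating sum of parities. -/
theorem sum_powerset_neg_one_pow_mul_val_sum {ι : Type*} {T : Finset ι} (hT : T.Nonempty)
    (x : ι → ZMod 2) :
    ∑ S ∈ T.powerset, (-1 : ℂ) ^ (S.card + 1) * ((∑ j ∈ S, x j).val : ℂ) =
      2 ^ (T.card - 1) * ∏ j ∈ T, ((x j).val : ℂ) := by
  have val_eq (S : Finset ι) : (-1 : ℂ) ^ (S.card + 1) * ((∑ j ∈ S, x j).val : ℂ) =
      (∏ j ∈ S, (2 * ((x j).val : ℂ) - 1) - ∏ _j ∈ S, (-1 : ℂ)) / 2 := by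
    have h : ∏ j ∈ S, (2 * ((x j).val : ℂ) - 1) =
        (-1) ^ S.card * (1 - 2 * ((∑ j ∈ S, x j).val : ℂ)) := by
      rw [one_sub_two_mul_val_sum, ← Finset.prod_const, ← Finset.prod_mul_distrib]
      exact Finset.prod_congr rfl fun j _ => by ring
    rw [h, Finset.prod_const]
    ring
  obtain ⟨k, hk⟩ := Nat.exists_eq_add_of_le' hT.card_pos
  simp_rw [val_eq]
  rw [← Finset.sum_div, Finset.sum_sub_distrib, ← Finset.prod_one_add, ← Finset.prod_one_add]
  simp only [add_sub_cancel, add_neg_cancel, Finset.prod_mul_distrib, Finset.prod_const, hk]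
  simp [pow_succ]
  ring

/-- Graphical Fourier transform rule (semantics): for bits `x : Fin n → ZMod 2`
regarded as real numbers (via `.val`),
`exp(i·α·∏ x_j) = ∏_{∅ ≠ S ⊆ [n]} exp(i·(−1)^{|S|+1}·(α/2^{n−1})·(⊕_{j∈S} x_j))`. -/
theorem fourier_transform_exp (n : ℕ) (hn : 1 ≤ n) (α : ℝ) (x : Fin n → ZMod 2) :
    Complex.exp (Complex.I * (α : ℂ) * ∏ j, (((x j).val : ℝ) : ℂ)) =
      ∏ S ∈ Finset.univ.powerset.filter (fun S : Finset (Fin n) => S.Nonempty),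
        Complex.exp (Complex.I * ((-1 : ℂ) ^ (S.card + 1) * ((α : ℂ) / 2 ^ (n - 1)) *
          (((∑ j ∈ S, x j).val : ℝ) : ℂ))) := by
  have hT : (Finset.univ : Finset (Fin n)).Nonempty := ⟨⟨0, hn⟩, Finset.mem_univ _⟩
  have key := sum_powerset_neg_one_pow_mul_val_sum hT x
  rw [Finset.card_univ, Fintype.card_fin] at key
  have h2 : (2 : ℂ) ^ (n - 1) ≠ 0 := pow_ne_zero _ two_ne_zero
  rw [Finset.prod_filter_of_ne, ← Complex.exp_sum]
  · congr 1
    simp only [Complex.ofReal_natCast]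
    calc Complex.I * (α : ℂ) * ∏ j, ((x j).val : ℂ)
        = Complex.I * ((α : ℂ) / 2 ^ (n - 1)) * (2 ^ (n - 1) * ∏ j, ((x j).val : ℂ)) := by
          field_simp
      _ = _ := by
          rw [← key, Finset.mul_sum]
          exact Finset.sum_congr rfl fun S _ => by ring
  · intro S _ hS
    by_contra hne
    rw [Finset.not_nonempty_iff_eq_empty] at hne
    simp [hne] at hS
end

section
/- For every bit q ∈ {0,1} and every real number r, Σ_{y∈{0,1}} exp(2πi·((1/4)·y + (1/2)·y·q + r)) = √2 · exp(2πi·(1/8 − (1/4)·q + r)). -/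
namespace Complex

theorem sqrt_two_mul_exp_pi_div_four_mul_I :
    (Real.sqrt 2 : ℂ) * exp (Real.pi / 4 * I) = 1 + I := by
  have h : (Real.sqrt 2 : ℂ) * Real.sqrt 2 = 2 := by
    exact_mod_cast Real.mul_self_sqrt zero_le_two
  have harg : (Real.pi / 4 : ℂ) = ((Real.pi / 4 : ℝ) : ℂ) := by push_cast; rfl
  rw [harg, exp_mul_I, ← ofReal_cos, ← ofReal_sin, Real.cos_pi_div_four, Real.sin_pi_div_four]
  push_cast
  linear_combination (1 + I) / 2 * h

theorem sqrt_two_mul_exp_neg_pi_div_four_mul_I :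
    (Real.sqrt 2 : ℂ) * exp (-(Real.pi / 4 * I)) = 1 - I := by
  have h : (Real.sqrt 2 : ℂ) * Real.sqrt 2 = 2 := by
    exact_mod_cast Real.mul_self_sqrt zero_le_two
  have harg : (-(Real.pi / 4 * I) : ℂ) = ((-(Real.pi / 4) : ℝ) : ℂ) * I := by push_cast; ring
  rw [harg, exp_mul_I, ← ofReal_cos, ← ofReal_sin, Real.cos_neg, Real.sin_neg,
    Real.cos_pi_div_four, Real.sin_pi_div_four]
  push_cast
  linear_combination (1 - I) / 2 * h

end Complex

/-- Scalar content of the [ω] rule: for a bit `q` and real `r`,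
`Σ_{y∈{0,1}} e^{2πi((1/4)y + (1/2)yq + r)} = √2 · e^{2πi(1/8 − (1/4)q + r)}`. -/
theorem omega_rule_scalar (q : ZMod 2) (r : ℝ) :
    (∑ y : ZMod 2,
        Complex.exp (2 * Real.pi * Complex.I *
          (((1 / 4) * (y.val : ℝ) + (1 / 2) * (y.val : ℝ) * (q.val : ℝ) + r : ℝ) : ℂ))) =
      (Real.sqrt 2 : ℂ) *
        Complex.exp (2 * Real.pi * Complex.I *
          ((1 / 8 - (1 / 4) * (q.val : ℝ) + r : ℝ) : ℂ)) := by
  have hsum (f : ZMod 2 → ℂ) : ∑ y, f y = f 0 + f 1 := Fin.sum_univ_two f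
  have h₀ : (0 : ZMod 2).val = 0 := rfl
  have h₁ : (1 : ZMod 2).val = 1 := rfl
  have hq : q = 0 ∨ q = 1 := by decide +revert
  rw [hsum, h₀, h₁]
  rcases hq with rfl | rfl
  · rw [h₀]
    push_cast
    have e₁ : (2 * Real.pi * Complex.I * (1 / 4 * 1 + 1 / 2 * 1 * 0 + r) : ℂ) =
        Real.pi / 2 * Complex.I + 2 * Real.pi * Complex.I * r := by ring
    have e₂ : (2 * Real.pi * Complex.I * (1 / 8 - 1 / 4 * 0 + r) : ℂ) =
        Real.pi / 4 * Complex.I + 2 * Real.pi * Complex.I * r := by ring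
    rw [e₁, e₂, Complex.exp_add, Complex.exp_add, Complex.exp_pi_div_two_mul_I, ← mul_assoc,
      Complex.sqrt_two_mul_exp_pi_div_four_mul_I]
    ring_nf
  · rw [h₁]
    push_cast
    have e₁ : (2 * Real.pi * Complex.I * (1 / 4 * 1 + 1 / 2 * 1 * 1 + r) : ℂ) =
        Real.pi * Complex.I + Real.pi / 2 * Complex.I + 2 * Real.pi * Complex.I * r := by ring
    have e₂ : (2 * Real.pi * Complex.I * (1 / 8 - 1 / 4 * 1 + r) : ℂ) =
        -(Real.pi / 4 * Complex.I) + 2 * Real.pi * Complex.I * r := by ring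
    rw [e₁, e₂, Complex.exp_add, Complex.exp_add, Complex.exp_add, Complex.exp_pi_mul_I,
      Complex.exp_pi_div_two_mul_I, ← mul_assoc, Complex.sqrt_two_mul_exp_neg_pi_div_four_mul_I]
    ring_nf
end

section
/- For every natural number n and all bits m_1, …, m_n ∈ {0,1}, Σ_{y∈{0,1}} i^y · ∏_{j=1}^{n} (−1)^{y·m_j} = √2 · exp(iπ/4) · ∏_{j=1}^{n} (−i)^{m_j} · ∏_{1 ≤ j < k ≤ n} (−1)^{m_j·m_k}, as an identity in ℂ. -/
/-- Splitting off the pairs that contain `0` from a product over the pairs `j < k`. -/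
theorem Fin.prod_filter_lt_succ {M : Type*} [CommMonoid M] (n : ℕ)
    (f : Fin (n + 1) → Fin (n + 1) → M) :
    ∏ p ∈ Finset.univ.filter (fun p : Fin (n + 1) × Fin (n + 1) => p.1 < p.2), f p.1 p.2 =
      (∏ j : Fin n, f 0 j.succ) *
        ∏ p ∈ Finset.univ.filter (fun p : Fin n × Fin n => p.1 < p.2), f p.1.succ p.2.succ := by
  simp [Finset.prod_filter, Fintype.prod_prod_type, Fin.prod_univ_succ]

theorem Complex.sqrt_two_mul_exp_I_mul_pi_div_four :
    (Real.sqrt 2 : ℂ) * Complex.exp (Complex.I * Real.pi / 4) = 1 + Complex.I := by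
  have harg : Complex.I * Real.pi / 4 = ((Real.pi / 4 : ℝ) : ℂ) * Complex.I := by
    push_cast
    ring
  have hsq : (Real.sqrt 2 : ℂ) * (Real.sqrt 2 : ℂ) = 2 := by
    rw [← Complex.ofReal_mul, Real.mul_self_sqrt (by norm_num)]
    norm_num
  rw [harg, Complex.exp_mul_I, ← Complex.ofReal_cos, ← Complex.ofReal_sin,
    Real.cos_pi_div_four, Real.sin_pi_div_four]
  push_cast
  linear_combination (1 + Complex.I) / 2 * hsq

theorem one_add_I_mul_prod_neg_one_pow (n : ℕ) (m : Fin n → ZMod 2) :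
    1 + Complex.I * ∏ j, (-1 : ℂ) ^ (m j).val =
      (1 + Complex.I) * (∏ j, (-Complex.I) ^ (m j).val) *
        ∏ p ∈ Finset.univ.filter (fun p : Fin n × Fin n => p.1 < p.2),
          (-1 : ℂ) ^ ((m p.1).val * (m p.2).val) := by
  induction n with
  | zero => simp
  | succ n ih =>
    have ih := ih fun j => m j.succ
    rw [Fin.prod_filter_lt_succ n fun j k => (-1 : ℂ) ^ ((m j).val * (m k).val),
      Fin.prod_univ_succ, Fin.prod_univ_succ]
    have hbit : (m 0).val = 0 ∨ (m 0).val = 1 := by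
      have := ZMod.val_lt (m 0)
      omega
    rcases hbit with h | h
    · simpa [h] using ih
    · simp only [h, pow_one, one_mul]
      have hsq : (∏ j : Fin n, (-1 : ℂ) ^ (m j.succ).val) ^ 2 = 1 := by
        rw [Finset.prod_pow_eq_pow_sum, ← pow_mul, mul_comm, pow_mul]
        simp
      set e := ∏ j : Fin n, (-1 : ℂ) ^ (m j.succ).val
      linear_combination (-Complex.I * e) * ih - hsq + e ^ 2 * Complex.I_sq


/-- Entrywise semantic content of hyper-local complementation:
`Σ_{y∈{0,1}} i^y · ∏_j (−1)^{y·m_j}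
  = √2 · e^{iπ/4} · ∏_j (−i)^{m_j} · ∏_{j<k} (−1)^{m_j·m_k}`. -/
theorem hyper_local_complementation (n : ℕ) (m : Fin n → ZMod 2) :
    (∑ y : ZMod 2, Complex.I ^ y.val * ∏ j, (-1 : ℂ) ^ (y.val * (m j).val)) =
      (Real.sqrt 2 : ℂ) * Complex.exp (Complex.I * Real.pi / 4) *
        (∏ j, (-Complex.I) ^ (m j).val) *
        ∏ p ∈ Finset.univ.filter (fun p : Fin n × Fin n => p.1 < p.2),
          (-1 : ℂ) ^ ((m p.1).val * (m p.2).val) := by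
  have hsum (f : ZMod 2 → ℂ) : ∑ y, f y = f 0 + f 1 := Fin.sum_univ_two f
  rw [hsum, Complex.sqrt_two_mul_exp_I_mul_pi_div_four, ← one_add_I_mul_prod_neg_one_pow]
  simp [ZMod.val_one]
end

section
/- For every natural number n, all bits m_1, …, m_n ∈ {0,1}, and every function g : {0,1} → ℂ, Σ_{y₀,y₁∈{0,1}} (−1)^{y₀·y₁} · (∏_{j=1}^{n} (−1)^{y₀·m_j}) · g(y₁) = 2 · g(m_1 ⊕ ⋯ ⊕ m_n), where ⊕ denotes XOR (so m_1 ⊕ ⋯ ⊕ m_n = 1 if an odd number of the m_j equal 1 and 0 otherwise), and exponents of −1 are natural numbers with bits regarded as natural numbers. -/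
theorem neg_one_pow_zmod_two_val_add {R : Type*} [CommRing R] (a b : ZMod 2) :
    (-1 : R) ^ (a + b).val = (-1) ^ a.val * (-1) ^ b.val := by
  rw [ZMod.val_add, ← pow_add, ← neg_one_pow_eq_pow_mod_two]

theorem prod_neg_one_pow_zmod_two_val {R ι : Type*} [CommRing R] (s : Finset ι)
    (m : ι → ZMod 2) :
    ∏ j ∈ s, (-1 : R) ^ (m j).val = (-1) ^ (∑ j ∈ s, m j).val := by
  classical
  induction s using Finset.induction_on with
  | empty => simp
  | insert a s ha ih =>
    rw [Finset.prod_insert ha, Finset.sum_insert ha, ih, neg_one_pow_zmod_two_val_add]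

/-- Entrywise semantic content of the hyper-pivot rule:
`Σ_{y₀,y₁} (−1)^{y₀y₁} · (∏_j (−1)^{y₀·m_j}) · g(y₁) = 2·g(m_1 ⊕ ⋯ ⊕ m_n)`. -/
theorem hyper_pivot (n : ℕ) (m : Fin n → ZMod 2) (g : ZMod 2 → ℂ) :
    (∑ y₀ : ZMod 2, ∑ y₁ : ZMod 2,
        (-1 : ℂ) ^ (y₀.val * y₁.val) * (∏ j, (-1 : ℂ) ^ (y₀.val * (m j).val)) * g y₁) =
      2 * g (∑ j, m j) := by
  have sum_bits (f : ZMod 2 → ℂ) : ∑ y, f y = f 0 + f 1 := Fin.sum_univ_two f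
  have val_one : (1 : ZMod 2).val = 1 := rfl
  simp only [sum_bits, ZMod.val_zero, val_one, zero_mul, one_mul, mul_zero, pow_zero, pow_one,
    Finset.prod_const_one, prod_neg_one_pow_zmod_two_val]
  obtain h | h : ∑ j, m j = 0 ∨ ∑ j, m j = 1 := by
    generalize ∑ j, m j = s
    revert s
    decide
  all_goals
    simp only [h, ZMod.val_zero, val_one]
    ring
end

section
/- For all bits X, Q, Q' ∈ {0,1} and all functions φ, ψ : {0,1} → ℂ, Σ_{y₀,y₁∈{0,1}} φ(y₀)^X · (−1)^{y₀·Q + y₀·y₁ + y₁·Q'} · ψ(y₁)^{1−X} = 2 · (−1)^{Q·Q'} · φ(Q')^X · ψ(Q)^{1−X}, where all exponents are natural numbers with bits regarded as natural numbers (and z^0 = 1 for all z ∈ ℂ). -/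
theorem ZMod.sum_univ_two {M : Type*} [AddCommMonoid M] (f : ZMod 2 → M) :
    ∑ y, f y = f 0 + f 1 :=
  Fin.sum_univ_two f

theorem ZMod.eq_zero_or_eq_one (x : ZMod 2) : x = 0 ∨ x = 1 := by
  revert x
  decide

/-- Generalized scalar form of the [Case] rule:
`Σ_{y₀,y₁} φ(y₀)^X·(−1)^{y₀Q + y₀y₁ + y₁Q'}·ψ(y₁)^{1−X}
  = 2·(−1)^{QQ'}·φ(Q')^X·ψ(Q)^{1−X}`. -/
theorem case_rule_scalar (X Q Q' : ZMod 2) (φ ψ : ZMod 2 → ℂ) :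
    (∑ y₀ : ZMod 2, ∑ y₁ : ZMod 2,
        (φ y₀) ^ X.val * (-1 : ℂ) ^ (y₀.val * Q.val + y₀.val * y₁.val + y₁.val * Q'.val) *
          (ψ y₁) ^ (1 - X.val)) =
      2 * (-1 : ℂ) ^ (Q.val * Q'.val) * (φ Q') ^ X.val * (ψ Q) ^ (1 - X.val) := by
  have val_one : (1 : ZMod 2).val = 1 := rfl
  simp only [ZMod.sum_univ_two]
  rcases ZMod.eq_zero_or_eq_one X with rfl | rfl <;>
    rcases ZMod.eq_zero_or_eq_one Q with rfl | rfl <;>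
    rcases ZMod.eq_zero_or_eq_one Q' with rfl | rfl <;>
    simp only [ZMod.val_zero, val_one] <;> ring
end

section
/- For every natural number n, every real number α, and all bits m_1, …, m_n ∈ {0,1}, Σ_{y₀,y₁∈{0,1}} (−1)^{y₀·y₁} · (∏_{j=1}^{n} (−1)^{y₀·m_j}) · exp(i·α·y₁) = 2 · ∏_{∅ ≠ E ⊆ Fin n} exp(i·α·(−2)^{|E|−1}·∏_{j∈E} m_j), where the product on the right ranges over all nonempty subsets E of Fin n, exponents of −1 are natural numbers with bits regarded as natural numbers, and bits are regarded as real numbers inside exp. -/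
theorem neg_one_pow_zmod_two_val (a : ZMod 2) :
    (-1 : ℂ) ^ a.val = 1 - 2 * (a.val : ℂ) := by
  have h : a.val < 2 := ZMod.val_lt a
  interval_cases a.val <;> norm_num

/-- Fourier expansion of a product over the nonempty subsets of the index set. -/
theorem neg_two_mul_sum_nonempty_powerset {ι R : Type*} [CommRing R] (s : Finset ι) (x : ι → R) :
    -2 * ∑ E ∈ s.powerset.filter (fun E : Finset ι => E.Nonempty),
      (-2 : R) ^ (E.card - 1) * ∏ j ∈ E, x j = (∏ j ∈ s, (1 - 2 * x j)) - 1 := by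
  classical
  have hprod : ∏ j ∈ s, (1 - 2 * x j) = ∑ E ∈ s.powerset, (-2 : R) ^ E.card * ∏ j ∈ E, x j := by
    simp_rw [sub_eq_add_neg, ← neg_mul, Finset.prod_one_add, Finset.prod_mul_distrib,
      Finset.prod_const]
  have hempty : s.powerset.filter (fun E : Finset ι => ¬ E.Nonempty) = {∅} := by
    ext E
    simp only [Finset.mem_filter, Finset.mem_powerset, Finset.not_nonempty_iff_eq_empty,
      Finset.mem_singleton, and_iff_right_iff_imp]
    rintro rfl
    exact Finset.empty_subset s
  rw [hprod, ← Finset.sum_filter_add_sum_filter_not s.powerset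
    (fun E : Finset ι => E.Nonempty), hempty, Finset.sum_singleton, Finset.card_empty,
    pow_zero, Finset.prod_empty, mul_one, add_sub_cancel_right, Finset.mul_sum]
  refine Finset.sum_congr rfl fun E hE => ?_
  rw [← mul_assoc, mul_pow_sub_one (Finset.mem_filter.mp hE).2.card_pos.ne']

/-- Entrywise semantic content of the Fourier hyper-pivot rule:
`Σ_{y₀,y₁} (−1)^{y₀y₁}·(∏_j (−1)^{y₀·m_j})·e^{iαy₁}
  = 2·∏_{∅ ≠ E ⊆ [n]} e^{iα(−2)^{|E|−1}·∏_{j∈E} m_j}`. -/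
theorem fourier_hyper_pivot (n : ℕ) (α : ℝ) (m : Fin n → ZMod 2) :
    (∑ y₀ : ZMod 2, ∑ y₁ : ZMod 2,
        (-1 : ℂ) ^ (y₀.val * y₁.val) * (∏ j, (-1 : ℂ) ^ (y₀.val * (m j).val)) *
          Complex.exp (Complex.I * (α : ℂ) * ((y₁.val : ℝ) : ℂ))) =
      2 * ∏ E ∈ Finset.univ.powerset.filter (fun E : Finset (Fin n) => E.Nonempty),
        Complex.exp (Complex.I * (α : ℂ) * (-2 : ℂ) ^ (E.card - 1) *
          ∏ j ∈ E, (((m j).val : ℝ) : ℂ)) := by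
  set P : ℂ := ∏ j, (-1 : ℂ) ^ (m j).val with hP
  have hS := neg_two_mul_sum_nonempty_powerset Finset.univ (fun j => ((m j).val : ℂ))
  simp_rw [← neg_one_pow_zmod_two_val] at hS
  rw [← hP] at hS
  have hP1 : P = 1 ∨ P = -1 := by
    rw [hP, Finset.prod_pow_eq_pow_sum]
    exact neg_one_pow_eq_or ℂ _
  have hsum (f : ZMod 2 → ℂ) : ∑ y, f y = f 0 + f 1 := Fin.sum_univ_two f
  have hone : (1 : ZMod 2).val = 1 := rfl
  simp only [hsum, ZMod.val_zero, hone, zero_mul, mul_zero, one_mul, pow_zero, pow_one,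
    Finset.prod_const_one, ← hP, Complex.ofReal_natCast, Nat.cast_zero, Nat.cast_one,
    mul_one, Complex.exp_zero]
  rw [← Complex.exp_sum]
  simp_rw [mul_assoc (Complex.I * (α : ℂ))]
  rw [← Finset.mul_sum]
  generalize (∑ E ∈ Finset.univ.powerset.filter (fun E : Finset (Fin n) => E.Nonempty),
    (-2 : ℂ) ^ (E.card - 1) * ∏ j ∈ E, ((m j).val : ℂ)) = S at hS ⊢
  rcases hP1 with h | h <;> rw [h] at hS ⊢
  · obtain rfl : S = 0 := by linear_combination (-1 / 2 : ℂ) * hS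
    simp only [mul_zero, Complex.exp_zero]
    ring
  · obtain rfl : S = 1 := by linear_combination (-1 / 2 : ℂ) * hS
    rw [mul_one]
    ring
end

section
/- For all natural numbers p ≥ 1 and N ≥ 2p, the following identity holds in the integers: Σ_{q=p}^{N} Σ_{r=1}^{p} C(p,r) · C(r, q−p) · (−2)^{q−1} = −(−2)^{p−1}, where C(a,b) denotes the binomial coefficient (with C(a,b) = 0 when b > a). -/
/-- The binomial theorem for `(x + 1) ^ r`, summed over a range that may exceed `r`. -/
theorem sum_range_choose_mul_pow {R : Type*} [CommSemiring R] (x : R) {r n : ℕ} (h : r < n) :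
    ∑ k ∈ Finset.range n, (Nat.choose r k : R) * x ^ k = (x + 1) ^ r := by
  rw [add_pow, ← Finset.sum_subset (Finset.range_subset_range.2 h)]
  · exact Finset.sum_congr rfl fun k _ => by rw [one_pow, mul_one, mul_comm]
  · intro k _ hk
    rw [Nat.choose_eq_zero_of_lt (by simpa using hk), Nat.cast_zero, zero_mul]

/-- The alternating sum of a nonempty row of Pascal's triangle without its first entry. -/
theorem sum_Icc_one_choose_mul_neg_one_pow {p : ℕ} (hp : 1 ≤ p) :
    ∑ r ∈ Finset.Icc 1 p, (Nat.choose p r : ℤ) * (-1) ^ r = -1 := by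
  have h := sum_range_choose_mul_pow (-1 : ℤ) p.lt_succ_self
  rw [Finset.range_eq_Ico, Finset.sum_eq_sum_Ico_succ_bot p.succ_pos, neg_add_cancel,
    zero_pow (by omega), Nat.choose_zero_right, Nat.cast_one, pow_zero, one_mul] at h
  exact eq_neg_of_add_eq_zero_right h

/-- Binomial identity from the proof of the Case hyper-pivot rule:
for `p ≥ 1` and `N ≥ 2p`,
`Σ_{q=p}^{N} Σ_{r=1}^{p} C(p,r)·C(r,q−p)·(−2)^{q−1} = −(−2)^{p−1}` in `ℤ`. -/
theorem case_hyper_pivot_binomial (p N : ℕ) (hp : 1 ≤ p) (hN : 2 * p ≤ N) :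
    (∑ q ∈ Finset.Icc p N, ∑ r ∈ Finset.Icc 1 p,
        (Nat.choose p r : ℤ) * (Nat.choose r (q - p) : ℤ) * (-2 : ℤ) ^ (q - 1)) =
      -(-2 : ℤ) ^ (p - 1) := by
  have inner (r : ℕ) (hr : r ∈ Finset.Icc 1 p) :
      ∑ q ∈ Finset.Icc p N,
          (Nat.choose p r : ℤ) * (Nat.choose r (q - p) : ℤ) * (-2 : ℤ) ^ (q - 1) =
        (-2) ^ (p - 1) * ((Nat.choose p r : ℤ) * (-1) ^ r) := by
    have hrp := (Finset.mem_Icc.1 hr).2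
    have h := sum_range_choose_mul_pow (-2 : ℤ) (show r < N + 1 - p by omega)
    rw [show (-2 : ℤ) + 1 = -1 by norm_num] at h
    rw [← h, ← Finset.Ico_add_one_right_eq_Icc, Finset.sum_Ico_eq_sum_range, Finset.mul_sum,
      Finset.mul_sum]
    refine Finset.sum_congr rfl fun k _ => ?_
    rw [Nat.add_sub_cancel_left, show p + k - 1 = p - 1 + k by omega, pow_add]
    ring
  rw [Finset.sum_comm, Finset.sum_congr rfl inner, ← Finset.mul_sum,
    sum_Icc_one_choose_mul_neg_one_pow hp, mul_neg_one]
end
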